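/- Let 𝔹 ⊂ ℝ^N be a nonempty compact set with diameter Δ, let θ > 0, 𝔸 ∈ ℝ^{m×N}, b ∈ ℝ^m, and T ∈ ℝ^{d×m}, and set S := { 𝔸x − b : x ∈ θ𝔹 } ⊂ ℝ^m. Assume: (i) there exists x₀ ∈ θ𝔹 with 𝔸x₀ = b; (ii) x_T ∈ θ𝔹 satisfies T(𝔸x_T − b) = 0; and (iii) for some constants C₂ ≥ 0 and u ≥ 0 the bound diam(S ∩ ker T) ≤ (C₂·w(S) + u·rad(S))/√d holds. Then ‖𝔸x_T − b‖₂ ≤ θ‖𝔸‖₂ (C₂·w(𝔹) + u·Δ)/√d. -/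

import Mathlib

open MeasureTheory Pointwise

/-- Euclidean (ℓ2) norm of a vector in ℝ^k. -/
noncomputable def norm2 {k : ℕ} (x : Fin k → ℝ) : ℝ := Real.sqrt (∑ i, (x i) ^ 2)

/-- Supremum (ℓ∞) norm of a vector in ℝ^k. -/
noncomputable def normInf {k : ℕ} (x : Fin k → ℝ) : ℝ := ⨆ i, |x i|

/-- Standard Euclidean inner product on ℝ^k. -/
def dotp {k : ℕ} (x y : Fin k → ℝ) : ℝ := ∑ i, x i * y i

/-- ℓ2 operator (spectral) norm of a matrix. -/
noncomputable def specNorm {p q : ℕ} (M : Matrix (Fin p) (Fin q) ℝ) : ℝ :=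
  ⨆ u : {u : Fin q → ℝ // norm2 u ≤ 1}, norm2 (M.mulVec u.1)

/-- ‖Aᵀ‖ := sup { ‖∑ i, y i • A i‖₂ : ‖y‖_∞ ≤ 1 }. -/
noncomputable def ATnorm {n m : ℕ} (A : Fin m → Matrix (Fin n) (Fin n) ℝ) : ℝ :=
  ⨆ y : {y : Fin m → ℝ // normInf y ≤ 1}, specNorm (∑ i, y.1 i • A i)

/-- Smallest eigenvalue of a real symmetric matrix, via the Rayleigh quotient. -/
noncomputable def lambdaMin {n : ℕ} (M : Matrix (Fin n) (Fin n) ℝ) : ℝ :=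
  ⨅ u : {u : Fin n → ℝ // u ≠ 0}, dotp u.1 (M.mulVec u.1) / (∑ i, (u.1 i) ^ 2)

/-- Largest eigenvalue of a real symmetric matrix, via the Rayleigh quotient. -/
noncomputable def lambdaMax {n : ℕ} (M : Matrix (Fin n) (Fin n) ℝ) : ℝ :=
  ⨆ u : {u : Fin n → ℝ // u ≠ 0}, dotp u.1 (M.mulVec u.1) / (∑ i, (u.1 i) ^ 2)

/-- Loewner order: X ⪯ Y iff Y - X is positive semidefinite. -/
def PSDle {n : ℕ} (X Y : Matrix (Fin n) (Fin n) ℝ) : Prop := (Y - X).PosSemidef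

/-- Frobenius norm of a matrix. -/
noncomputable def frobNorm {n : ℕ} (X : Matrix (Fin n) (Fin n) ℝ) : ℝ :=
  Real.sqrt (∑ i, ∑ j, (X i j) ^ 2)

/-- A random matrix `T : Ω → ℝ^{d×m}` is a random projection with constants `c, C` if
for every `ε ∈ (0,1)` and `x ∈ ℝ^m`, `(1-ε)‖x‖² ≤ ‖Tx‖² ≤ (1+ε)‖x‖²` holds with
probability at least `1 - c·exp(-C ε² d)`. -/
def IsRandomProjection {Ω : Type*} [MeasurableSpace Ω] (μ : Measure Ω) {d m : ℕ}
    (T : Ω → Matrix (Fin d) (Fin m) ℝ) (c C : ℝ) : Prop :=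
  ∀ ε ∈ Set.Ioo (0 : ℝ) 1, ∀ x : Fin m → ℝ,
    1 - c * Real.exp (-C * ε ^ 2 * d) ≤
      (μ {ω | (1 - ε) * (norm2 x) ^ 2 ≤ (norm2 ((T ω).mulVec x)) ^ 2 ∧
              (norm2 ((T ω).mulVec x)) ^ 2 ≤ (1 + ε) * (norm2 x) ^ 2}).toReal

/-- Gaussian width of a set `S ⊆ ℝ^k`. -/
noncomputable def gaussWidth {k : ℕ} (S : Set (Fin k → ℝ)) : ℝ :=
  ∫ g, (⨆ x : S, dotp g x.1) ∂(Measure.pi fun _ : Fin k => ProbabilityTheory.gaussianReal 0 1)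

/-- Radius (w.r.t. the Euclidean norm) of a set `S ⊆ ℝ^k`. -/
noncomputable def rad2 {k : ℕ} (S : Set (Fin k → ℝ)) : ℝ := ⨆ x : S, norm2 x.1

/-- Diameter (w.r.t. the Euclidean norm) of a set `S ⊆ ℝ^k`. -/
noncomputable def diam2 {k : ℕ} (S : Set (Fin k → ℝ)) : ℝ :=
  ⨆ p : ↥(S ×ˢ S), norm2 (p.1.1 - p.1.2)

open ProbabilityTheory in
/-- standard Gaussian on a finite product. -/
noncomputable def gam (ι : Type) [Fintype ι] : Measure (ι → ℝ) :=
  Measure.pi fun _ : ι => ProbabilityTheory.gaussianReal 0 1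

instance (ι : Type) [Fintype ι] : IsProbabilityMeasure (gam ι) := by
  unfold gam; infer_instance

lemma gam_charFunDual (ι : Type) [Fintype ι] [DecidableEq ι] (L : StrongDual ℝ (ι → ℝ)) :
    charFunDual (gam ι) L =
      Complex.exp (-((∑ i, (L (Pi.single i 1)) ^ 2 : ℝ) : ℂ) / 2) := by
  unfold gam
  rw [charFunDual_pi]
  have h : ∀ i : ι, charFunDual (ProbabilityTheory.gaussianReal 0 1)
      (L.comp (.single ℝ (fun _ : ι => ℝ) i)) =
      Complex.exp (-(((L (Pi.single i 1)) ^ 2 : ℝ) : ℂ) / 2) := by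
    intro i
    have e : ⇑(L.comp (.single ℝ (fun _ : ι => ℝ) i)) = (L (Pi.single i 1) * ·) := by
      ext x
      have : (Pi.single i x : ι → ℝ) = x • Pi.single i 1 := by
        rw [← Pi.single_smul]; simp
      simp only [ContinuousLinearMap.comp_apply, ContinuousLinearMap.single_apply]
      rw [this, map_smul, smul_eq_mul, mul_comm]
    rw [charFunDual_eq_charFun_map_one, e, ProbabilityTheory.gaussianReal_map_const_mul,
      ProbabilityTheory.charFun_gaussianReal]
    congr 1
    simp
    ring
  rw [Finset.prod_congr rfl (fun i _ => h i), ← Complex.exp_sum]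
  congr 1
  push_cast
  rw [← Finset.sum_neg_distrib, Finset.sum_div]

lemma gam_law {n : ℕ} {ι κ : Type} [Fintype ι] [Fintype κ] [DecidableEq ι] [DecidableEq κ]
    (M : Matrix (Fin n) ι ℝ) (M' : Matrix (Fin n) κ ℝ)
    (h : M * M.transpose = M' * M'.transpose) :
    (gam ι).map M.mulVec = (gam κ).map M'.mulVec := by
  have key : ∀ (ι : Type) [Fintype ι] [DecidableEq ι] (M : Matrix (Fin n) ι ℝ)
      (L : StrongDual ℝ (Fin n → ℝ)),
      charFunDual ((gam ι).map M.mulVec) L = Complex.exp (-((dotProduct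
        (fun j => L (Pi.single j 1)) ((M * M.transpose).mulVec fun j => L (Pi.single j 1)) : ℝ) : ℂ) / 2) := by
    intro ι _ _ M L
    have e : M.mulVec = (LinearMap.toContinuousLinearMap M.mulVecLin : (ι → ℝ) →L[ℝ] (Fin n → ℝ)) := by
      ext; simp
    rw [e, charFunDual_map, gam_charFunDual]
    have hL : ∀ v : Fin n → ℝ, L v = dotProduct (fun j => L (Pi.single j 1)) v := by
      intro v
      conv_lhs => rw [pi_eq_sum_univ' v]
      simp only [map_sum, map_smul, dotProduct, smul_eq_mul]
      exact Finset.sum_congr rfl fun i _ => by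
        rw [mul_comm]
    congr 4
    rw [← Matrix.mulVec_mulVec, Matrix.dotProduct_mulVec, ← Matrix.mulVec_transpose]
    simp only [dotProduct, ← sq]
    refine Finset.sum_congr rfl fun i _ => ?_
    congr 1
    simp only [ContinuousLinearMap.comp_apply]
    rw [hL, ← e, Matrix.mulVec_single_one]
    simp [Matrix.mulVec, dotProduct, Matrix.col, mul_comm]
  have hm : ∀ (ι : Type) [Fintype ι] (M : Matrix (Fin n) ι ℝ), Measurable M.mulVec := by
    intro ι _ M
    exact (Continuous.matrix_mulVec continuous_const continuous_id).measurable
  have := Measure.isProbabilityMeasure_map (μ := gam ι) (hm ι M).aemeasurable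
  have := Measure.isProbabilityMeasure_map (μ := gam κ) (hm κ M').aemeasurable
  refine Measure.ext_of_charFunDual (funext fun L => ?_)
  rw [key, key, h]

lemma gam_integrable {ι : Type} [Fintype ι] (f : (ι → ℝ) → ℝ) (hf : Continuous f) (K : ℝ)
    (hK : ∀ y, |f y| ≤ K * ‖y‖) : Integrable f (gam ι) := by
  have h1 : Integrable (fun y : ι → ℝ => K * ‖y‖) (gam ι) := by
    have h2 : Integrable (fun y : ι → ℝ => ∑ i, ‖y i‖) (gam ι) := by
      refine integrable_finsetSum _ fun i _ => ?_
      unfold gam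
      exact integrable_comp_eval (μ := fun _ : ι => ProbabilityTheory.gaussianReal 0 1) (f := fun x : ℝ => ‖x‖)
        ((ProbabilityTheory.memLp_id_gaussianReal 1).integrable (by simp)).norm
    refine (h2.mono' continuous_norm.aestronglyMeasurable
      (Filter.Eventually.of_forall fun y => ?_)).const_mul K
    rw [norm_norm]
    exact (pi_norm_le_iff_of_nonneg (Finset.sum_nonneg fun i _ => norm_nonneg _)).2 fun i =>
      Finset.single_le_sum (f := fun i => ‖y i‖) (fun i _ => norm_nonneg _) (Finset.mem_univ i)
  exact h1.mono' hf.aestronglyMeasurable (Filter.Eventually.of_forall hK)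

/-- support function -/
noncomputable def supf {k : ℕ} (B : Set (Fin k → ℝ)) (y : Fin k → ℝ) : ℝ := ⨆ x : B, dotp y x.1

lemma dotp_cont {k : ℕ} : Continuous fun p : (Fin k → ℝ) × (Fin k → ℝ) => dotp p.1 p.2 := by
  unfold dotp; fun_prop

lemma supf_bdd {k : ℕ} {B : Set (Fin k → ℝ)} (hB : IsCompact B) (y : Fin k → ℝ) :
    BddAbove (Set.range fun x : B => dotp y x.1) := by
  have := (hB.image (f := fun x => dotp y x) (dotp_cont.comp (by fun_prop : Continuous fun x => (y, x)))).bddAbove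
  rwa [Set.image_eq_range] at this

lemma supf_cont {k : ℕ} {B : Set (Fin k → ℝ)} (hB : IsCompact B) : Continuous (supf B) := by
  have := hB.continuous_sSup (f := fun y x => dotp y x) dotp_cont
  have e : supf B = fun y => sSup ((fun x => dotp y x) '' B) := by
    ext y; rw [sSup_image']; rfl
  rw [e]; exact this

lemma supf_bound {k : ℕ} {B : Set (Fin k → ℝ)} (hB : IsCompact B) (hne : B.Nonempty) :
    ∃ K : ℝ, 0 ≤ K ∧ ∀ y, |supf B y| ≤ K * ‖y‖ := by
  obtain ⟨R, hR0, hR⟩ := hB.isBounded.exists_pos_norm_le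
  have hd : ∀ y, ∀ x ∈ B, |dotp y x| ≤ k * R * ‖y‖ := by
    intro y x hx
    unfold dotp
    calc |∑ i, y i * x i| ≤ ∑ i, |y i * x i| := Finset.abs_sum_le_sum_abs _ _
      _ ≤ ∑ i : Fin k, R * ‖y‖ := by
        refine Finset.sum_le_sum fun i _ => ?_
        rw [abs_mul, mul_comm]
        exact mul_le_mul ((norm_le_pi_norm x i).trans (hR x hx)) (norm_le_pi_norm y i) (abs_nonneg _) hR0.le
      _ = _ := by simp; ring
  refine ⟨k * R, by positivity, fun y => ?_⟩
  have := hne.to_subtype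
  obtain ⟨x, hx⟩ := hne
  rw [abs_le]
  constructor
  · exact (abs_le.1 (hd y x hx)).1.trans (le_ciSup (supf_bdd hB y) ⟨x, hx⟩)
  · exact ciSup_le fun x => (abs_le.1 (hd y x.1 x.2)).2

lemma supf_integrable {k : ℕ} {B : Set (Fin k → ℝ)} (hB : IsCompact B) (hne : B.Nonempty)
    {ι : Type} [Fintype ι] (M : Matrix (Fin k) ι ℝ) :
    Integrable (fun z => supf B (M.mulVec z)) (gam ι) := by
  obtain ⟨K, hK0, hK⟩ := supf_bound hB hne
  set Φ := (LinearMap.toContinuousLinearMap M.mulVecLin : (ι → ℝ) →L[ℝ] (Fin k → ℝ))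
  have e : ∀ z, M.mulVec z = Φ z := fun z => by simp [Φ]
  refine gam_integrable _ ((supf_cont hB).comp (Continuous.matrix_mulVec continuous_const continuous_id)) (K * ‖Φ‖) fun y => ?_
  rw [e, mul_assoc]
  exact (hK _).trans (mul_le_mul_of_nonneg_left (Φ.le_opNorm y) hK0)

lemma supf_law {n : ℕ} {ι κ : Type} [Fintype ι] [Fintype κ] [DecidableEq ι] [DecidableEq κ]
    {B : Set (Fin n → ℝ)} (hB : IsCompact B)
    (M : Matrix (Fin n) ι ℝ) (M' : Matrix (Fin n) κ ℝ)
    (h : M * M.transpose = M' * M'.transpose) :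
    ∫ z, supf B (M.mulVec z) ∂(gam ι) = ∫ z, supf B (M'.mulVec z) ∂(gam κ) := by
  have hm : ∀ (ι : Type) [Fintype ι] (M : Matrix (Fin n) ι ℝ), Measurable M.mulVec := by
    intro ι _ M
    exact (Continuous.matrix_mulVec continuous_const continuous_id).measurable
  rw [← integral_map (f := supf B) (hm ι M).aemeasurable
    (supf_cont hB).aestronglyMeasurable, gam_law M M' h,
    integral_map (hm κ M').aemeasurable (supf_cont hB).aestronglyMeasurable]

lemma dotp_add {k : ℕ} (a b x : Fin k → ℝ) : dotp (a + b) x = dotp a x + dotp b x := by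
  simp [dotp, add_mul, Finset.sum_add_distrib]

lemma dotp_smul {k : ℕ} (c : ℝ) (a x : Fin k → ℝ) : dotp (c • a) x = c * dotp a x := by
  simp [dotp, mul_assoc, Finset.mul_sum]

lemma supf_mid {k : ℕ} {B : Set (Fin k → ℝ)} (hB : IsCompact B) (hne : B.Nonempty)
    (p a b : Fin k → ℝ) (h : (2 : ℝ) • p = a + b) : 2 * supf B p ≤ supf B a + supf B b := by
  have := hne.to_subtype
  have : supf B p ≤ (supf B a + supf B b) / 2 := by
    refine ciSup_le fun x => ?_
    have h1 : dotp a x.1 ≤ supf B a := le_ciSup (supf_bdd hB a) x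
    have h2 : dotp b x.1 ≤ supf B b := le_ciSup (supf_bdd hB b) x
    have h3 : 2 * dotp p x.1 = dotp a x.1 + dotp b x.1 := by rw [← dotp_smul, h, dotp_add]
    linarith
  linarith

lemma supf_smul {k : ℕ} {B : Set (Fin k → ℝ)} (c : ℝ) (hc : 0 ≤ c) (y : Fin k → ℝ) :
    supf B (c • y) = c * supf B y := by
  unfold supf
  simp only [dotp_smul]
  rw [Real.mul_iSup_of_nonneg hc]

open scoped MatrixOrder in
lemma psd_factor {n : ℕ} (M : Matrix (Fin n) (Fin n) ℝ) (h : M.PosSemidef) :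
    ∃ C : Matrix (Fin n) (Fin n) ℝ, M = C.conjTranspose * C :=
  CStarAlgebra.nonneg_iff_eq_star_mul_self.1 h.nonneg

/-- Gaussian comparison for linear images. -/
lemma supf_compare {m N : ℕ} {B : Set (Fin N → ℝ)} (hB : IsCompact B) (hne : B.Nonempty)
    (A : Matrix (Fin m) (Fin N) ℝ) (L : ℝ) (hL : 0 ≤ L)
    (hA : ((L ^ 2) • (1 : Matrix (Fin N) (Fin N) ℝ) - A.transpose * A).PosSemidef) :
    ∫ g, supf B (A.transpose.mulVec g) ∂(gam (Fin m)) ≤ L * ∫ g, supf B g ∂(gam (Fin N)) := by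
  obtain ⟨C, hC⟩ := psd_factor _ hA
  rw [Matrix.conjTranspose_eq_transpose_of_trivial] at hC
  set P : Matrix (Fin N) (Fin m ⊕ Fin N) ℝ := Matrix.fromCols A.transpose 0
  set Q : Matrix (Fin N) (Fin m ⊕ Fin N) ℝ := Matrix.fromCols A.transpose C.transpose
  set Q' : Matrix (Fin N) (Fin m ⊕ Fin N) ℝ := Matrix.fromCols A.transpose (-C.transpose)
  have e0 : A.transpose * A + C.transpose * C = (L ^ 2) • 1 := by rw [← hC]; abel
  have e1 : A.transpose * A.transpose.transpose = P * P.transpose := by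
    simp [P, Matrix.transpose_fromCols, Matrix.fromCols_mul_fromRows]
  have e2 : Q * Q.transpose = (L • (1 : Matrix (Fin N) (Fin N) ℝ)) * (L • (1 : Matrix (Fin N) (Fin N) ℝ)).transpose := by
    simp [Q, Matrix.transpose_fromCols, Matrix.fromCols_mul_fromRows, e0, smul_smul, sq]
  have e3 : Q' * Q'.transpose = (L • (1 : Matrix (Fin N) (Fin N) ℝ)) * (L • (1 : Matrix (Fin N) (Fin N) ℝ)).transpose := by
    simp [Q', Matrix.transpose_fromCols, Matrix.fromCols_mul_fromRows, e0, smul_smul, sq]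
  have l1 := supf_law hB _ _ e1
  have l2 := supf_law hB _ _ e2
  have l3 := supf_law hB _ _ e3
  have l4 : ∫ z, supf B ((L • (1 : Matrix (Fin N) (Fin N) ℝ)).mulVec z) ∂(gam (Fin N)) =
      L * ∫ g, supf B g ∂(gam (Fin N)) := by
    rw [← integral_const_mul]
    simp only [Matrix.smul_mulVec, Matrix.one_mulVec, supf_smul L hL]
  have hPQ : (2 : ℝ) • P = Q + Q' := by
    ext i j; rcases j with j | j <;> simp [P, Q, Q', two_mul]
  have main : ∫ z, 2 * supf B (P.mulVec z) ∂(gam (Fin m ⊕ Fin N)) ≤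
      ∫ z, (supf B (Q.mulVec z) + supf B (Q'.mulVec z)) ∂(gam (Fin m ⊕ Fin N)) := by
    refine integral_mono ((supf_integrable hB hne P).const_mul 2)
      ((supf_integrable hB hne Q).add (supf_integrable hB hne Q')) fun z => ?_
    refine supf_mid hB hne _ _ _ ?_
    rw [← Matrix.smul_mulVec, hPQ, Matrix.add_mulVec]
  rw [integral_const_mul, integral_add (supf_integrable hB hne Q) (supf_integrable hB hne Q')] at main
  linarith

lemma norm2_eq {k : ℕ} (x : Fin k → ℝ) : norm2 x = ‖WithLp.toLp 2 x‖ := by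
  simp [norm2, EuclideanSpace.norm_eq]

lemma norm2_sq {k : ℕ} (x : Fin k → ℝ) : norm2 x ^ 2 = dotProduct x x := by
  rw [norm2, Real.sq_sqrt (Finset.sum_nonneg fun i _ => sq_nonneg _)]
  simp [dotProduct, sq]

lemma norm2_nonneg {k : ℕ} (x : Fin k → ℝ) : 0 ≤ norm2 x := Real.sqrt_nonneg _

lemma norm2_smul {k : ℕ} (c : ℝ) (x : Fin k → ℝ) : norm2 (c • x) = |c| * norm2 x := by
  simp [norm2_eq, norm_smul]

lemma norm2_cont {k : ℕ} : Continuous (norm2 : (Fin k → ℝ) → ℝ) := by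
  unfold norm2; fun_prop

lemma norm2_mulVec_bound {p q : ℕ} (M : Matrix (Fin p) (Fin q) ℝ) :
    ∃ K, ∀ x, norm2 (M.mulVec x) ≤ K * norm2 x := by
  refine ⟨‖LinearMap.toContinuousLinearMap (Matrix.toLpLin 2 2 M)‖, fun x => ?_⟩
  have := (LinearMap.toContinuousLinearMap (Matrix.toLpLin 2 2 M)).le_opNorm (WithLp.toLp 2 x)
  rw [norm2_eq, norm2_eq]
  simpa using this

lemma specNorm_bdd {p q : ℕ} (M : Matrix (Fin p) (Fin q) ℝ) :
    BddAbove (Set.range fun u : {u : Fin q → ℝ // norm2 u ≤ 1} => norm2 (M.mulVec u.1)) := by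
  obtain ⟨K, hK⟩ := norm2_mulVec_bound M
  refine ⟨|K|, ?_⟩
  rintro _ ⟨u, rfl⟩
  refine (hK u.1).trans ?_
  nlinarith [abs_nonneg K, le_abs_self K, u.2, norm2_nonneg u.1]

lemma specNorm_nonneg {p q : ℕ} (M : Matrix (Fin p) (Fin q) ℝ) : 0 ≤ specNorm M :=
  Real.iSup_nonneg fun _ => norm2_nonneg _

lemma specNorm_le {p q : ℕ} (M : Matrix (Fin p) (Fin q) ℝ) (x : Fin q → ℝ) :
    norm2 (M.mulVec x) ≤ specNorm M * norm2 x := by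
  rcases (norm2_nonneg x).eq_or_lt with h | h
  · obtain ⟨K, hK⟩ := norm2_mulVec_bound M
    have := hK x
    rw [← h] at this ⊢
    simpa using this
  · have h1 : norm2 ((norm2 x)⁻¹ • x) ≤ 1 := by
      rw [norm2_smul, abs_of_pos (inv_pos.2 h), inv_mul_cancel₀ h.ne']
    have h2 : norm2 (M.mulVec ((norm2 x)⁻¹ • x)) ≤ specNorm M :=
      le_ciSup (specNorm_bdd M) ⟨_, h1⟩
    rw [Matrix.mulVec_smul, norm2_smul, abs_of_pos (inv_pos.2 h), inv_mul_le_iff₀ h] at h2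
    linarith

lemma specNorm_psd {p q : ℕ} (M : Matrix (Fin p) (Fin q) ℝ) :
    ((specNorm M ^ 2) • (1 : Matrix (Fin q) (Fin q) ℝ) - M.transpose * M).PosSemidef := by
  refine Matrix.PosSemidef.of_dotProduct_mulVec_nonneg ?_ fun x => ?_
  · rw [Matrix.IsHermitian, Matrix.conjTranspose_eq_transpose_of_trivial]
    simp [Matrix.transpose_sub]
  · have h1 := pow_le_pow_left₀ (norm2_nonneg _) (specNorm_le M x) 2
    rw [mul_pow, norm2_sq, norm2_sq] at h1
    simp only [star_trivial, Matrix.sub_mulVec, Matrix.smul_mulVec, Matrix.one_mulVec,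
      dotProduct_sub, dotProduct_smul, smul_eq_mul, ← Matrix.mulVec_mulVec]
    rw [Matrix.dotProduct_mulVec, Matrix.vecMul_transpose]
    linarith

lemma supf_image {N m : ℕ} {B : Set (Fin N → ℝ)} (hne : B.Nonempty) (hB : IsCompact B)
    (θ : ℝ) (hθ : 0 < θ) (A : Matrix (Fin m) (Fin N) ℝ) (b g : Fin m → ℝ) :
    supf {v | ∃ x ∈ θ • B, v = A.mulVec x - b} g =
      θ * supf B (A.transpose.mulVec g) - dotp g b := by
  have key : ∀ x, dotp g (A.mulVec (θ • x) - b) = θ * dotp (A.transpose.mulVec g) x - dotp g b := by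
    intro x
    change dotProduct g _ = θ * dotProduct _ x - dotProduct g b
    rw [dotProduct_sub, Matrix.mulVec_smul, dotProduct_smul, Matrix.dotProduct_mulVec,
      Matrix.mulVec_transpose, smul_eq_mul]
  have hle : ∀ v ∈ {v | ∃ x ∈ θ • B, v = A.mulVec x - b},
      dotp g v ≤ θ * supf B (A.transpose.mulVec g) - dotp g b := by
    rintro _ ⟨_, ⟨x, hx, rfl⟩, rfl⟩
    have := le_ciSup (supf_bdd hB (A.transpose.mulVec g)) ⟨x, hx⟩
    have h2 := mul_le_mul_of_nonneg_left this hθ.le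
    simp only [key]
    unfold supf
    linarith
  have hneS : Nonempty {v | ∃ x ∈ θ • B, v = A.mulVec x - b} := by
    obtain ⟨x, hx⟩ := hne
    exact ⟨⟨_, θ • x, Set.smul_mem_smul_set hx, rfl⟩⟩
  apply le_antisymm
  · exact ciSup_le fun v => hle v.1 v.2
  · have := hne.to_subtype
    have h1 : supf B (A.transpose.mulVec g) ≤
        (supf {v | ∃ x ∈ θ • B, v = A.mulVec x - b} g + dotp g b) / θ := by
      refine ciSup_le fun x => ?_
      rw [le_div_iff₀ hθ]
      have h2 : dotp g (A.mulVec (θ • x.1) - b) ≤ supf {v | ∃ x ∈ θ • B, v = A.mulVec x - b} g := by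
        refine le_ciSup (f := fun v : {v | ∃ x ∈ θ • B, v = A.mulVec x - b} => dotp g v.1) ?_
          ⟨_, θ • x.1, Set.smul_mem_smul_set x.2, rfl⟩
        refine ⟨θ * supf B (A.transpose.mulVec g) - dotp g b, ?_⟩
        rintro _ ⟨v, rfl⟩
        exact hle v.1 v.2
      rw [key] at h2
      linarith
    rw [le_div_iff₀ hθ] at h1
    linarith

lemma dotp_gam {m : ℕ} (b : Fin m → ℝ) :
    Integrable (fun g => dotp g b) (gam (Fin m)) ∧ ∫ g, dotp g b ∂(gam (Fin m)) = 0 := by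
  have h : ∀ i : Fin m, Integrable (fun g : Fin m → ℝ => g i * b i) (gam (Fin m)) := by
    intro i
    unfold gam
    exact (integrable_eval (μ := fun _ : Fin m => ProbabilityTheory.gaussianReal 0 1)
      ((ProbabilityTheory.memLp_id_gaussianReal 1).integrable (by simp))).mul_const _
  constructor
  · exact integrable_finsetSum _ fun i _ => h i
  · unfold dotp
    rw [integral_finsetSum _ fun i _ => h i]
    refine Finset.sum_eq_zero fun i _ => ?_
    rw [integral_mul_const]
    unfold gam
    rw [integral_eval (μ := fun _ : Fin m => ProbabilityTheory.gaussianReal 0 1)]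
    simp

lemma width_image {N m : ℕ} {B : Set (Fin N → ℝ)} (hne : B.Nonempty) (hB : IsCompact B)
    (θ : ℝ) (hθ : 0 < θ) (A : Matrix (Fin m) (Fin N) ℝ) (b : Fin m → ℝ) :
    gaussWidth {v | ∃ x ∈ θ • B, v = A.mulVec x - b} ≤ θ * (specNorm A * gaussWidth B) := by
  change ∫ g, supf {v | ∃ x ∈ θ • B, v = A.mulVec x - b} g ∂(gam (Fin m)) ≤
    θ * (specNorm A * ∫ g, supf B g ∂(gam (Fin N)))
  simp only [supf_image hne hB θ hθ]
  rw [integral_sub ((supf_integrable hB hne _).const_mul θ) (dotp_gam b).1, (dotp_gam b).2,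
    integral_const_mul, sub_zero]
  exact mul_le_mul_of_nonneg_left (supf_compare hB hne A _ (specNorm_nonneg A) (specNorm_psd A)) hθ.le

lemma diam2_bdd {k : ℕ} {B : Set (Fin k → ℝ)} (hB : IsCompact B) :
    BddAbove (Set.range fun p : ↥(B ×ˢ B) => norm2 (p.1.1 - p.1.2)) := by
  have hc : Continuous fun p : (Fin k → ℝ) × (Fin k → ℝ) => norm2 (p.1 - p.2) :=
    norm2_cont.comp (continuous_fst.sub continuous_snd)
  have := ((hB.prod hB).image hc).bddAbove
  rwa [Set.image_eq_range] at this

lemma diam2_le {k : ℕ} {B : Set (Fin k → ℝ)} (hB : IsCompact B) {x y : Fin k → ℝ}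
    (hx : x ∈ B) (hy : y ∈ B) : norm2 (x - y) ≤ diam2 B :=
  le_ciSup (diam2_bdd hB) ⟨(x, y), hx, hy⟩

/-- M* bound argument: if x_T ∈ θ𝔹 satisfies T(𝔸x_T − b) = 0, some x₀ ∈ θ𝔹
satisfies 𝔸x₀ = b, and diam(S ∩ ker T) ≤ (C₂ w(S) + u rad(S))/√d for S = 𝔸(θ𝔹) − b, then
‖𝔸x_T − b‖₂ ≤ θ‖𝔸‖₂ (C₂ w(𝔹) + uΔ)/√d. -/
theorem stmt_19 {N m d : ℕ} (hd : 0 < d)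
    (B : Set (Fin N → ℝ)) (hBne : B.Nonempty) (hBcpt : IsCompact B)
    (Δ : ℝ) (hΔ : diam2 B = Δ) (θ : ℝ) (hθ : 0 < θ)
    (𝔸 : Matrix (Fin m) (Fin N) ℝ) (b : Fin m → ℝ) (T : Matrix (Fin d) (Fin m) ℝ)
    (S : Set (Fin m → ℝ)) (hS : S = {v | ∃ x ∈ θ • B, v = 𝔸.mulVec x - b})
    (C₂ u : ℝ) (hC₂ : 0 ≤ C₂) (hu : 0 ≤ u)
    (x₀ : Fin N → ℝ) (hx₀B : x₀ ∈ θ • B) (hx₀ : 𝔸.mulVec x₀ = b)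
    (xT : Fin N → ℝ) (hxTB : xT ∈ θ • B) (hxT : T.mulVec (𝔸.mulVec xT - b) = 0)
    (hM : diam2 (S ∩ {v | T.mulVec v = 0}) ≤
      (C₂ * gaussWidth S + u * rad2 S) / Real.sqrt d) :
    norm2 (𝔸.mulVec xT - b) ≤
      θ * specNorm 𝔸 * (C₂ * gaussWidth B + u * Δ) / Real.sqrt d := by
  subst hS hΔ
  set S : Set (Fin m → ℝ) := {v | ∃ x ∈ θ • B, v = 𝔸.mulVec x - b} with hSdef
  have hScpt : IsCompact S := by
    have e : S = (fun x => 𝔸.mulVec x - b) '' (θ • B) := by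
      ext v; simp only [hSdef, Set.mem_setOf_eq, Set.mem_image, eq_comm]
    rw [e]
    exact (hBcpt.smul θ).image
      ((Continuous.matrix_mulVec continuous_const continuous_id).sub continuous_const)
  have hkc : IsClosed {v : Fin m → ℝ | T.mulVec v = 0} :=
    isClosed_eq (Continuous.matrix_mulVec continuous_const continuous_id) continuous_const
  have h0 : (0 : Fin m → ℝ) ∈ S ∩ {v | T.mulVec v = 0} :=
    ⟨⟨x₀, hx₀B, by rw [hx₀, sub_self]⟩, by simp⟩
  have hT : 𝔸.mulVec xT - b ∈ S ∩ {v | T.mulVec v = 0} := ⟨⟨xT, hxTB, rfl⟩, hxT⟩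
  have h1 := diam2_le (hScpt.inter_right hkc) hT h0
  rw [sub_zero] at h1
  have hrad : rad2 S ≤ θ * specNorm 𝔸 * diam2 B := by
    have : Nonempty S := ⟨⟨0, h0.1⟩⟩
    refine ciSup_le ?_
    rintro ⟨_, _, ⟨x, hx, rfl⟩, rfl⟩
    obtain ⟨y, hy, rfl⟩ := hx₀B
    have e : 𝔸.mulVec (θ • x) - b = θ • 𝔸.mulVec (x - y) := by
      rw [← hx₀, ← Matrix.mulVec_sub, ← Matrix.mulVec_smul, smul_sub]
    change norm2 (𝔸.mulVec (θ • x) - b) ≤ _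
    rw [e, norm2_smul, abs_of_pos hθ, mul_assoc]
    exact mul_le_mul_of_nonneg_left ((specNorm_le 𝔸 _).trans
      (mul_le_mul_of_nonneg_left (diam2_le hBcpt hx hy) (specNorm_nonneg 𝔸))) hθ.le
  have hw := width_image hBne hBcpt θ hθ 𝔸 b
  refine h1.trans (hM.trans ?_)
  apply div_le_div_of_nonneg_right _ (Real.sqrt_nonneg _)
  have a1 := mul_le_mul_of_nonneg_left hw hC₂
  have a2 := mul_le_mul_of_nonneg_left hrad hu
  calc _ ≤ _ := add_le_add a1 a2
    _ = _ := by ring
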